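/- arXiv:math/0606371 — 14 statements merged into one kernel-verified Lean document; each statement's English description precedes it below -/
import Mathlib

section
/- Let a_j = inf I_j and b_j = sup I_j (taken in the extended reals, allowing infinite values), and set α = Σ_{j=1}^m a_j and β = Σ_{j=1}^m b_j. Then co(S, 𝒥_S) is nonempty if and only if the following three conditions hold: (a) α ≤ 1 ≤ β; (b) if α = 1 then a_j ∈ I_j for every j; and (c) if β = 1 then b_j ∈ I_j for every j. -/
lemma cih_coe_sum {ι : Type*} (s : Finset ι) (f : ι → ℝ) :
    ((∑ j ∈ s, f j : ℝ) : EReal) = ∑ j ∈ s, (f j : EReal) := by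
  classical
  induction s using Finset.induction_on with
  | empty => simp
  | insert i s hi ih => rw [Finset.sum_insert hi, Finset.sum_insert hi, EReal.coe_add, ih]

lemma cih_sum_ne_top {ι : Type*} (s : Finset ι) (a : ι → EReal) (h : ∀ j, a j ≠ ⊤) :
    ∑ j ∈ s, a j ≠ ⊤ := by
  classical
  induction s using Finset.induction_on with
  | empty => simp
  | insert i s hi ih => rw [Finset.sum_insert hi]; exact EReal.add_ne_top (h i) ih

lemma cih_low {ι : Type*} (s : Finset ι) (I : ι → Set ℝ) (a : ι → EReal)
    (hne : ∀ j, (I j).Nonempty) (ht : ∀ j, a j ≠ ⊤)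
    (h : ∀ j (v : EReal), a j < v → ∃ r ∈ I j, (r : EReal) < v) :
    ∀ c : ℝ, ∑ j ∈ s, a j < c → ∃ ξ : ι → ℝ, (∀ j, ξ j ∈ I j) ∧ ∑ j ∈ s, ξ j < c := by
  classical
  induction s using Finset.induction_on with
  | empty =>
    intro c hc
    choose ξ hξ using hne
    exact ⟨ξ, hξ, by simpa using hc⟩
  | insert i s hi ih =>
    intro c hc
    rw [Finset.sum_insert hi, add_comm,
      ← EReal.lt_sub_iff_add_lt (.inr (cih_sum_ne_top s a ht)) (.inl (ht i))] at hc
    obtain ⟨v, hv1, hv2⟩ := EReal.lt_iff_exists_real_btwn.1 hc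
    obtain ⟨ξ, hξ, hs⟩ := ih v hv1
    have h2 := EReal.add_lt_of_lt_sub hv2
    rw [add_comm, ← EReal.lt_sub_iff_add_lt (.inl (by simp)) (.inl (by simp))] at h2
    obtain ⟨r, hr, hrv⟩ := h i _ h2
    have hrv' : r < c - v := by exact_mod_cast hrv
    refine ⟨Function.update ξ i r, fun j => ?_, ?_⟩
    · by_cases hj : j = i
      · subst hj; simpa using hr
      · simpa [hj] using hξ j
    · rw [Finset.sum_insert hi, Finset.sum_update_of_notMem hi]
      simp only [Function.update_self]
      linarith

lemma cih_high {ι : Type*} (s : Finset ι) (I : ι → Set ℝ) (b : ι → EReal)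
    (hne : ∀ j, (I j).Nonempty)
    (h : ∀ j (v : EReal), v < b j → ∃ r ∈ I j, v < (r : EReal)) :
    ∀ c : ℝ, (c : EReal) < ∑ j ∈ s, b j → ∃ ξ : ι → ℝ, (∀ j, ξ j ∈ I j) ∧ c < ∑ j ∈ s, ξ j := by
  classical
  induction s using Finset.induction_on with
  | empty =>
    intro c hc
    choose ξ hξ using hne
    exact ⟨ξ, hξ, by simpa using hc⟩
  | insert i s hi ih =>
    intro c hc
    rw [Finset.sum_insert hi, add_comm,
      ← EReal.sub_lt_iff (.inr (by simp)) (.inr (by simp))] at hc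
    obtain ⟨v, hv1, hv2⟩ := EReal.lt_iff_exists_real_btwn.1 hc
    obtain ⟨ξ, hξ, hs⟩ := ih v hv2
    rw [EReal.sub_lt_iff (.inr (by simp)) (.inr (by simp)), add_comm,
      ← EReal.sub_lt_iff (.inr (by simp)) (.inr (by simp))] at hv1
    obtain ⟨r, hr, hrv⟩ := h i _ hv1
    have hrv' : c - v < r := by exact_mod_cast hrv
    refine ⟨Function.update ξ i r, fun j => ?_, ?_⟩
    · by_cases hj : j = i
      · subst hj; simpa using hr
      · simpa [hj] using hξ j
    · rw [Finset.sum_insert hi, Finset.sum_update_of_notMem hi]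
      simp only [Function.update_self]
      linarith

lemma cih_mid {ι : Type*} [Fintype ι] (I : ι → Set ℝ) (hoc : ∀ j, (I j).OrdConnected)
    (ξ η : ι → ℝ) (hξ : ∀ j, ξ j ∈ I j) (hη : ∀ j, η j ∈ I j)
    (h1 : ∑ j, ξ j ≤ 1) (h2 : 1 ≤ ∑ j, η j) :
    ∃ ζ : ι → ℝ, (∀ j, ζ j ∈ I j) ∧ ∑ j, ζ j = 1 := by
  have h : (1 : ℝ) ∈ segment ℝ (∑ j, ξ j) (∑ j, η j) := by
    rw [segment_eq_Icc (h1.trans h2)]; exact ⟨h1, h2⟩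
  obtain ⟨p, q, hp, hq, hpq, e⟩ := h
  refine ⟨fun j => p • ξ j + q • η j, fun j => (hoc j).convex (hξ j) (hη j) hp hq hpq, ?_⟩
  rw [Finset.sum_add_distrib, ← Finset.smul_sum, ← Finset.smul_sum, e]

lemma cih_eq_low {ι : Type*} [Fintype ι] (a : ι → EReal) (ξ : ι → ℝ)
    (h : ∀ j, a j ≤ ξ j) (e : ∑ j, a j = ((∑ j, ξ j : ℝ) : EReal)) (j : ι) :
    (ξ j : EReal) = a j := by
  classical
  refine le_antisymm ?_ (h j)
  have h1 : ∑ i ∈ Finset.univ.erase j, a i ≤ ((∑ i ∈ Finset.univ.erase j, ξ i : ℝ) : EReal) := by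
    rw [cih_coe_sum]; exact Finset.sum_le_sum fun i _ => h i
  rw [← Finset.add_sum_erase _ _ (Finset.mem_univ j),
    ← Finset.add_sum_erase _ _ (Finset.mem_univ j), EReal.coe_add] at e
  have h2 := e.symm.le.trans (add_le_add_right h1 (a j))
  generalize (∑ i ∈ Finset.univ.erase j, ξ i : ℝ) = r at h2
  generalize a j = t at h2
  induction t with
  | bot => rw [← EReal.coe_add] at h2; simp at h2
  | top => simp
  | coe t => norm_cast at h2 ⊢; linarith

lemma cih_eq_high {ι : Type*} [Fintype ι] (a : ι → EReal) (ξ : ι → ℝ)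
    (h : ∀ j, (ξ j : EReal) ≤ a j) (e : ∑ j, a j = ((∑ j, ξ j : ℝ) : EReal)) (j : ι) :
    (ξ j : EReal) = a j := by
  classical
  refine le_antisymm (h j) ?_
  have h1 : ((∑ i ∈ Finset.univ.erase j, ξ i : ℝ) : EReal) ≤ ∑ i ∈ Finset.univ.erase j, a i := by
    rw [cih_coe_sum]; exact Finset.sum_le_sum fun i _ => h i
  rw [← Finset.add_sum_erase _ _ (Finset.mem_univ j),
    ← Finset.add_sum_erase _ _ (Finset.mem_univ j), EReal.coe_add] at e
  have h2 := (add_le_add_right h1 (a j)).trans e.le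
  generalize (∑ i ∈ Finset.univ.erase j, ξ i : ℝ) = r at h2
  generalize a j = t at h2
  induction t with
  | bot => simp
  | top =>
    rw [← EReal.coe_add, EReal.top_add_coe, top_le_iff] at h2
    exact absurd h2 (EReal.coe_ne_top _)
  | coe t => norm_cast at h2 ⊢; linarith


/-- Characterization of nonemptiness of the convex interval hull via the
extended-real infima and suprema of the intervals. -/
theorem convex_interval_hull_nonempty_iff {L : Type*} [AddCommGroup L] [Module ℝ L]
    (m : ℕ) (x : Fin m → L) (I : Fin m → Set ℝ)
    (hne : ∀ j, (I j).Nonempty) (hoc : ∀ j, (I j).OrdConnected)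
    (a b : Fin m → EReal)
    (ha : ∀ j, a j = sInf ((fun r : ℝ => (r : EReal)) '' I j))
    (hb : ∀ j, b j = sSup ((fun r : ℝ => (r : EReal)) '' I j)) :
    ({y : L | ∃ ξ : Fin m → ℝ,
        (∀ j, ξ j ∈ I j) ∧ (∑ j, ξ j) = 1 ∧ y = ∑ j, ξ j • x j}).Nonempty ↔
      ((∑ j, a j) ≤ 1 ∧ (1 : EReal) ≤ ∑ j, b j) ∧
      ((∑ j, a j) = 1 → ∀ j, ∃ r ∈ I j, (r : EReal) = a j) ∧
      ((∑ j, b j) = 1 → ∀ j, ∃ r ∈ I j, (r : EReal) = b j) := by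
  have hal : ∀ j, ∀ r ∈ I j, a j ≤ (r : EReal) := fun j r hr => by
    rw [ha j]; exact sInf_le ⟨r, hr, rfl⟩
  have hbl : ∀ j, ∀ r ∈ I j, (r : EReal) ≤ b j := fun j r hr => by
    rw [hb j]; exact le_sSup ⟨r, hr, rfl⟩
  constructor
  · rintro ⟨y, ξ, hξ, hs, -⟩
    have hs' : ((∑ j, ξ j : ℝ) : EReal) = 1 := by rw [hs]; rfl
    refine ⟨⟨?_, ?_⟩, fun e j => ⟨ξ j, hξ j, ?_⟩, fun e j => ⟨ξ j, hξ j, ?_⟩⟩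
    · rw [← hs', cih_coe_sum]
      exact Finset.sum_le_sum fun j _ => hal j _ (hξ j)
    · rw [← hs', cih_coe_sum]
      exact Finset.sum_le_sum fun j _ => hbl j _ (hξ j)
    · exact cih_eq_low a ξ (fun j => hal j _ (hξ j)) (e.trans hs'.symm) j
    · exact cih_eq_high b ξ (fun j => hbl j _ (hξ j)) (e.trans hs'.symm) j
  · rintro ⟨⟨h1, h2⟩, h3, h4⟩
    have hlow : ∃ ξ : Fin m → ℝ, (∀ j, ξ j ∈ I j) ∧ ∑ j, ξ j ≤ 1 := by
      rcases h1.lt_or_eq with hlt | heq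
      · obtain ⟨ξ, hξ, hs⟩ := cih_low Finset.univ I a hne
          (fun j => by
            obtain ⟨r, hr⟩ := hne j
            exact ((hal j r hr).trans_lt (EReal.coe_lt_top r)).ne)
          (fun j v hv => by
            rw [ha j, sInf_lt_iff] at hv
            obtain ⟨_, ⟨r, hr, rfl⟩, hv⟩ := hv
            exact ⟨r, hr, hv⟩) 1 (by simpa using hlt)
        exact ⟨ξ, hξ, hs.le⟩
      · choose ξ hξ he using h3 heq
        refine ⟨ξ, hξ, ?_⟩
        have : ((∑ j, ξ j : ℝ) : EReal) = 1 := by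
          rw [cih_coe_sum, ← heq]; exact Finset.sum_congr rfl fun j _ => he j
        exact le_of_eq (by exact_mod_cast this)
    have hhigh : ∃ ξ : Fin m → ℝ, (∀ j, ξ j ∈ I j) ∧ 1 ≤ ∑ j, ξ j := by
      rcases h2.lt_or_eq with hlt | heq
      · obtain ⟨ξ, hξ, hs⟩ := cih_high Finset.univ I b hne
          (fun j v hv => by
            rw [hb j, lt_sSup_iff] at hv
            obtain ⟨_, ⟨r, hr, rfl⟩, hv⟩ := hv
            exact ⟨r, hr, hv⟩) 1 (by simpa using hlt)
        exact ⟨ξ, hξ, hs.le⟩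
      · choose ξ hξ he using h4 heq.symm
        refine ⟨ξ, hξ, ?_⟩
        have : ((∑ j, ξ j : ℝ) : EReal) = 1 := by
          rw [cih_coe_sum, heq]; exact Finset.sum_congr rfl fun j _ => he j
        exact ge_of_eq (by exact_mod_cast this)
    obtain ⟨ξ, hξ, hs⟩ := hlow
    obtain ⟨η, hη, ht⟩ := hhigh
    obtain ⟨ζ, hζ, hz⟩ := cih_mid I hoc ξ η hξ hη hs ht
    exact ⟨_, ζ, hζ, hz, rfl⟩
end

section
/- The set co(S, 𝒥_S) is bounded (with respect to the norm of L) if and only if at least one of the following holds: (i) every interval I_j is bounded below; (ii) every interval I_j is bounded above; (iii) at most one of the intervals I₁, …, I_m is unbounded. -/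
theorem coord_upper {m : ℕ} (I : Fin m → Set ℝ) (j : Fin m)
    (h : BddAbove (I j) ∨ ∀ i, i ≠ j → BddBelow (I i)) :
    ∃ B : ℝ, ∀ ξ : Fin m → ℝ, (∀ i, ξ i ∈ I i) → (∑ i, ξ i) = 1 → ξ j ≤ B := by
  rcases h with ⟨B, hB⟩ | h
  · exact ⟨B, fun ξ hξ _ => hB (hξ j)⟩
  · have h' : ∀ i, ∃ l : ℝ, i ≠ j → l ∈ lowerBounds (I i) := by
      intro i
      by_cases hi : i = j
      · exact ⟨0, fun h => absurd hi h⟩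
      · obtain ⟨l, hl⟩ := h i hi
        exact ⟨l, fun _ => hl⟩
    choose l hl using h'
    refine ⟨1 - ∑ i ∈ Finset.univ.erase j, l i, fun ξ hξ hs => ?_⟩
    have h1 := Finset.add_sum_erase Finset.univ ξ (Finset.mem_univ j)
    have h2 : ∑ i ∈ Finset.univ.erase j, l i ≤ ∑ i ∈ Finset.univ.erase j, ξ i :=
      Finset.sum_le_sum fun i hi => hl i (Finset.ne_of_mem_erase hi) (hξ i)
    linarith

theorem coord_lower {m : ℕ} (I : Fin m → Set ℝ) (j : Fin m)
    (h : BddBelow (I j) ∨ ∀ i, i ≠ j → BddAbove (I i)) :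
    ∃ B : ℝ, ∀ ξ : Fin m → ℝ, (∀ i, ξ i ∈ I i) → (∑ i, ξ i) = 1 → B ≤ ξ j := by
  rcases h with ⟨B, hB⟩ | h
  · exact ⟨B, fun ξ hξ _ => hB (hξ j)⟩
  · have h' : ∀ i, ∃ l : ℝ, i ≠ j → l ∈ upperBounds (I i) := by
      intro i
      by_cases hi : i = j
      · exact ⟨0, fun h => absurd hi h⟩
      · obtain ⟨l, hl⟩ := h i hi
        exact ⟨l, fun _ => hl⟩
    choose l hl using h'
    refine ⟨1 - ∑ i ∈ Finset.univ.erase j, l i, fun ξ hξ hs => ?_⟩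
    have h1 := Finset.add_sum_erase Finset.univ ξ (Finset.mem_univ j)
    have h2 : ∑ i ∈ Finset.univ.erase j, ξ i ≤ ∑ i ∈ Finset.univ.erase j, l i :=
      Finset.sum_le_sum fun i hi => hl i (Finset.ne_of_mem_erase hi) (hξ i)
    linarith

theorem hull_unbounded {L : Type*} [NormedAddCommGroup L]
    [NormedSpace ℝ L] (m : ℕ) (x : Fin m → L) (hx : Function.Injective x)
    (I : Fin m → Set ℝ) (hne : ∀ j, (I j).Nonempty) (hoc : ∀ j, (I j).OrdConnected)
    (j k : Fin m) (hjk : j ≠ k) (hj : ¬ BddBelow (I j)) (hk : ¬ BddAbove (I k)) :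
    ¬ Bornology.IsBounded {y : L | ∃ ξ : Fin m → ℝ,
        (∀ j, ξ j ∈ I j) ∧ (∑ j, ξ j) = 1 ∧ y = ∑ j, ξ j • x j} := by
  intro hb
  obtain ⟨C, hC⟩ := hb.exists_norm_le
  choose a ha using hne
  have hd : 0 < ‖x k - x j‖ := norm_pos_iff.2 (sub_ne_zero.2 fun h => hjk (hx h).symm)
  -- shift by `t` from coordinate `j` to coordinate `k`, after normalising the sum
  set s : ℝ := 1 - ∑ i, a i with hs
  have key : ∀ t : ℝ, 0 ≤ t → s ≤ t → ‖(∑ i, a i • x i) + s • x j + t • (x k - x j)‖ ≤ C := by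
    intro t ht hst
    apply hC
    refine ⟨fun i => a i + (if i = j then s - t else 0) + (if i = k then t else 0), ?_, ?_, ?_⟩
    · intro i
      by_cases hij : i = j
      · subst hij
        obtain ⟨b, hbI, hbl⟩ := not_bddBelow_iff.1 hj (a i + (s - t))
        simp only [if_true, if_neg hjk, add_zero]
        exact (hoc i).out hbI (ha i) ⟨hbl.le, by linarith⟩
      · by_cases hik : i = k
        · subst hik
          obtain ⟨b, hbI, hbl⟩ := not_bddAbove_iff.1 hk (a i + t)
          simp only [if_true, if_neg hij, add_zero]
          exact (hoc i).out (ha i) hbI ⟨by linarith, hbl.le⟩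
        · simpa [hij, hik] using ha i
    · simp [Finset.sum_add_distrib, hs]
      ring
    · simp only [add_smul, Finset.sum_add_distrib, ite_smul, zero_smul, Finset.sum_ite_eq',
        Finset.mem_univ, if_true, sub_smul, smul_sub]
      abel
  set c := (∑ i, a i • x i) + s • x j with hc
  set t : ℝ := |s| + (|C| + ‖c‖ + 1) / ‖x k - x j‖ with htd
  have hq : 0 ≤ (|C| + ‖c‖ + 1) / ‖x k - x j‖ := by positivity
  have ht : 0 ≤ t := by positivity
  have h1 := key t ht (by linarith [le_abs_self s])
  have h2 : ‖t • (x k - x j)‖ ≤ ‖c + t • (x k - x j)‖ + ‖c‖ := by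
    have := norm_sub_le (c + t • (x k - x j)) c
    simpa using this
  rw [norm_smul, Real.norm_of_nonneg ht, htd, add_mul, div_mul_cancel₀ _ hd.ne'] at h2
  have h3 : 0 ≤ |s| * ‖x k - x j‖ := by positivity
  rw [← htd] at h2
  linarith [le_abs_self C]

/-- The convex interval hull is bounded iff all intervals are bounded below,
or all are bounded above, or at most one interval is unbounded. -/
theorem convex_interval_hull_bounded_iff {L : Type*} [NormedAddCommGroup L]
    [NormedSpace ℝ L] (m : ℕ) (x : Fin m → L) (hx : Function.Injective x)
    (I : Fin m → Set ℝ) (hne : ∀ j, (I j).Nonempty) (hoc : ∀ j, (I j).OrdConnected) :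
    Bornology.IsBounded {y : L | ∃ ξ : Fin m → ℝ,
        (∀ j, ξ j ∈ I j) ∧ (∑ j, ξ j) = 1 ∧ y = ∑ j, ξ j • x j} ↔
      (∀ j, BddBelow (I j)) ∨ (∀ j, BddAbove (I j)) ∨
      (∀ j k : Fin m, ¬(BddBelow (I j) ∧ BddAbove (I j)) →
        ¬(BddBelow (I k) ∧ BddAbove (I k)) → j = k) := by
  constructor
  · intro hb
    by_contra! hcon
    obtain ⟨⟨a, ha⟩, ⟨b, hb'⟩, p, q, hp, hq, hpq⟩ := hcon
    have hno : ∀ j k, j ≠ k → ¬ BddBelow (I j) → ¬ BddAbove (I k) → False :=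
      fun j k hjk hj hk => hull_unbounded m x hx I hne hoc j k hjk hj hk hb
    by_cases hab : a = b
    · subst hab
      have hc : ∀ c, c ≠ a → ¬ (BddBelow (I c) → ¬ BddAbove (I c)) := by
        intro c hca h
        by_cases h1 : BddBelow (I c)
        · exact hno a c hca.symm ha (h h1)
        · exact hno c a hca h1 hb'
      by_cases hpa : p = a
      · exact hc q (fun h => hpq (hpa.trans h.symm)) hq
      · exact hc p hpa hp
    · exact hno a b hab ha hb'
  · intro h
    have hu : ∀ j, BddAbove (I j) ∨ ∀ i, i ≠ j → BddBelow (I i) := by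
      intro j
      rcases h with h | h | h
      · exact Or.inr fun i _ => h i
      · exact Or.inl (h j)
      · by_contra! hcon
        obtain ⟨h1, i, hij, h2⟩ := hcon
        exact hij (h i j (fun h => h2 h.1) (fun h => h1 h.2))
    have hl : ∀ j, BddBelow (I j) ∨ ∀ i, i ≠ j → BddAbove (I i) := by
      intro j
      rcases h with h | h | h
      · exact Or.inl (h j)
      · exact Or.inr fun i _ => h i
      · by_contra! hcon
        obtain ⟨h1, i, hij, h2⟩ := hcon
        exact hij (h i j (fun h => h2 h.2) (fun h => h1 h.1))
    choose U hU using fun j => coord_upper I j (hu j)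
    choose l hl' using fun j => coord_lower I j (hl j)
    refine isBounded_iff_forall_norm_le.2 ⟨∑ j, max |l j| |U j| * ‖x j‖, ?_⟩
    rintro y ⟨ξ, hξ, hs, rfl⟩
    refine (norm_sum_le _ _).trans (Finset.sum_le_sum fun j _ => ?_)
    rw [norm_smul, Real.norm_eq_abs]
    exact mul_le_mul_of_nonneg_right
      (abs_le_max_abs_abs (hl' j ξ hξ hs) (hU j ξ hξ hs)) (norm_nonneg _)
end

section
/- Let T : L → K be an affine map between real vector spaces, and suppose co(S, 𝒥_S) is bounded. Let Q = T(S) = {y₁, …, y_k} be the image set, with y₁, …, y_k pairwise distinct (k ≤ m), and for each j = 1, …, k define the interval I'_j as the Minkowski sum Σ { I_i : T(x_i) = y_j } of the intervals attached to the points of S mapped to y_j. Then co(Q, 𝒥_Q) = T(co(S, 𝒥_S)), where 𝒥_Q = {I'₁, …, I'_k}. -/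
open scoped Classical in
/-- The image of a bounded convex interval hull under an affine map `T` is the
convex interval hull of the image set, where the interval attached to a point
`y_j` of the image is the Minkowski sum of the intervals attached to the points
of `S` mapped to `y_j`. -/
theorem convex_interval_hull_affine_image {L K : Type*}
    [NormedAddCommGroup L] [NormedSpace ℝ L] [NormedAddCommGroup K] [NormedSpace ℝ K]
    (m k : ℕ) (x : Fin m → L) (hx : Function.Injective x)
    (I : Fin m → Set ℝ) (hne : ∀ j, (I j).Nonempty) (hoc : ∀ j, (I j).OrdConnected)
    (T : L →ᵃ[ℝ] K)
    (hbdd : Bornology.IsBounded {z : L | ∃ ξ : Fin m → ℝ,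
      (∀ j, ξ j ∈ I j) ∧ (∑ j, ξ j) = 1 ∧ z = ∑ j, ξ j • x j})
    (y : Fin k → K) (hy : Function.Injective y)
    (hxy : ∀ i, ∃ j, T (x i) = y j) (hyx : ∀ j, ∃ i, T (x i) = y j)
    (I' : Fin k → Set ℝ)
    (hI' : ∀ j, I' j = {t : ℝ | ∃ ξ : Fin m → ℝ,
      (∀ i, T (x i) = y j → ξ i ∈ I i) ∧
      t = ∑ i ∈ Finset.univ.filter (fun i => T (x i) = y j), ξ i}) :
    {z : K | ∃ η : Fin k → ℝ,
        (∀ j, η j ∈ I' j) ∧ (∑ j, η j) = 1 ∧ z = ∑ j, η j • y j} =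
      T '' {z : L | ∃ ξ : Fin m → ℝ,
        (∀ j, ξ j ∈ I j) ∧ (∑ j, ξ j) = 1 ∧ z = ∑ j, ξ j • x j} := by
  choose σ hσ using hxy
  have hiff : ∀ i j, T (x i) = y j ↔ σ i = j := fun i j => by
    rw [hσ i]; exact hy.eq_iff
  have hT : ∀ ξ : Fin m → ℝ, ∑ j, ξ j = 1 → T (∑ j, ξ j • x j) = ∑ j, ξ j • y (σ j) := by
    intro ξ h1
    have hd : ∀ z, T z = T.linear z + T 0 := fun z => congrFun (AffineMap.decomp T) z
    have : ∀ j, y (σ j) = T.linear (x j) + T 0 := fun j => by rw [← hσ j]; exact hd _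
    rw [hd]
    simp only [this, smul_add, Finset.sum_add_distrib, ← Finset.sum_smul, h1, one_smul,
      map_sum, map_smul]
  have hS : ∀ ξ : Fin m → ℝ,
      ∑ j, ∑ i ∈ Finset.univ.filter (fun i => T (x i) = y j), ξ i = ∑ i, ξ i := by
    intro ξ
    rw [← Finset.sum_fiberwise Finset.univ σ ξ]
    refine Finset.sum_congr rfl fun j _ => Finset.sum_congr ?_ fun _ _ => rfl
    ext i; simp [hiff]
  have hV : ∀ ξ : Fin m → ℝ,
      ∑ j, (∑ i ∈ Finset.univ.filter (fun i => T (x i) = y j), ξ i) • y j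
        = ∑ i, ξ i • y (σ i) := by
    intro ξ
    rw [← Finset.sum_fiberwise Finset.univ σ (fun i => ξ i • y (σ i))]
    refine Finset.sum_congr rfl fun j _ => ?_
    rw [Finset.sum_smul]
    refine Finset.sum_congr ?_ fun i hi => ?_
    · ext i; simp [hiff]
    · rw [(Finset.mem_filter.1 hi).2]
  ext z
  constructor
  · rintro ⟨η, hη, h1, rfl⟩
    have hη' : ∀ j, ∃ ξ : Fin m → ℝ, (∀ i, T (x i) = y j → ξ i ∈ I i) ∧
        η j = ∑ i ∈ Finset.univ.filter (fun i => T (x i) = y j), ξ i := by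
      intro j
      have := hη j
      rw [hI' j] at this
      exact this
    choose ζ hζ hs using hη'
    have hs' : ∀ j, η j = ∑ i ∈ Finset.univ.filter (fun i => T (x i) = y j), ζ (σ i) i := by
      intro j
      rw [hs j]
      refine Finset.sum_congr rfl fun i hi => ?_
      rw [(hiff i j).1 (Finset.mem_filter.1 hi).2]
    have h1' : ∑ i, ζ (σ i) i = 1 := by
      rw [← h1, ← hS]
      exact Finset.sum_congr rfl fun j _ => (hs' j).symm
    refine ⟨_, ⟨fun i => ζ (σ i) i, fun i => hζ _ i (hσ i), h1', rfl⟩, ?_⟩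
    rw [hT _ h1', ← hV]
    exact Finset.sum_congr rfl fun j _ => by rw [hs' j]
  · rintro ⟨_, ⟨ξ, hξ, h1, rfl⟩, rfl⟩
    refine ⟨fun j => ∑ i ∈ Finset.univ.filter (fun i => T (x i) = y j), ξ i, ?_, ?_, ?_⟩
    · intro j
      rw [hI' j]
      exact ⟨ξ, fun i _ => hξ i, rfl⟩
    · rw [hS, h1]
    · rw [hT ξ h1, hV]
end

section
/- The bound n·C(m, n) of the preceding vertex-count theorem is best possible: let n = ⌊m/2⌋ + 1, let S = {e₁, …, e_m} be the set of standard unit vectors of ℝ^m, and let 𝒥_S consist of m copies of the interval [0, 2/(2(m−n)+1)]. Then co(S, 𝒥_S) is a polytope with exactly n·C(m, n) vertices, i.e., the set of extreme points of co(S, 𝒥_S) has exactly n·(m choose n) elements. -/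
/-- The candidate vertex: `c` on `A`, `c/2` at `j`, zero elsewhere. -/
noncomputable def vtx {m : ℕ} (c : ℝ) (A : Finset (Fin m)) (j : Fin m) : Fin m → ℝ :=
  fun i => if i ∈ A then c else if i = j then c / 2 else 0

/-- The polytope in coordinates. -/
def cutCube (m : ℕ) (c : ℝ) : Set (Fin m → ℝ) :=
  {y | (∀ j, 0 ≤ y j ∧ y j ≤ c) ∧ ∑ j, y j = 1}

lemma vtx_sum {m : ℕ} (c : ℝ) (A : Finset (Fin m)) (j : Fin m) (hj : j ∉ A) :
    ∑ i, vtx c A j i = A.card * c + c / 2 := by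
  have h : ∀ i, vtx c A j i = (if i ∈ A then c else 0) + (if i = j then c / 2 else 0) := by
    intro i
    unfold vtx
    by_cases h1 : i ∈ A
    · have : i ≠ j := fun h => hj (h ▸ h1)
      simp [h1, this]
    · simp [h1]
  simp_rw [h, Finset.sum_add_distrib]
  simp

lemma vtx_extreme {m k : ℕ} (c : ℝ) (hc : 0 < c) (hkc : (k : ℝ) * c + c / 2 = 1)
    (A : Finset (Fin m)) (j : Fin m) (hj : j ∉ A) (hA : A.card = k) :
    vtx c A j ∈ Set.extremePoints ℝ (cutCube m c) := by
  have hsum : ∑ i, vtx c A j i = 1 := by rw [vtx_sum c A j hj, hA, hkc]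
  rw [mem_extremePoints]
  refine ⟨⟨fun i => ?_, hsum⟩, ?_⟩
  · unfold vtx
    split_ifs <;> constructor <;> linarith
  have key : ∀ x ∈ cutCube m c, (∀ i, i ≠ j → x i = vtx c A j i) → x = vtx c A j := by
    intro x hx h
    have h2 : ∑ i, x i = ∑ i, vtx c A j i := by rw [hsum, hx.2]
    rw [← Finset.add_sum_erase _ _ (Finset.mem_univ j),
      ← Finset.add_sum_erase _ (vtx c A j) (Finset.mem_univ j),
      Finset.sum_congr rfl (fun i hi => h i (Finset.ne_of_mem_erase hi))] at h2
    funext i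
    by_cases hi : i = j
    · subst hi; linarith
    · exact h i hi
  rintro x hx y hy ⟨a, b, ha, hb, hab, hxy⟩
  have hi : ∀ i, i ≠ j → x i = vtx c A j i ∧ y i = vtx c A j i := by
    intro i hij
    have h := congrFun hxy i
    simp only [Pi.add_apply, Pi.smul_apply, smul_eq_mul] at h
    have h1 := hx.1 i
    have h2 := hy.1 i
    obtain rfl : b = 1 - a := by linarith
    unfold vtx at h ⊢
    by_cases hiA : i ∈ A
    · simp only [hiA, if_true] at h ⊢
      constructor <;> nlinarith
    · simp only [hiA, hij, if_false] at h ⊢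
      constructor <;> nlinarith
  exact ⟨key x hx fun i h => (hi i h).1, key y hy fun i h => (hi i h).2⟩

lemma frac_unique {m : ℕ} (c : ℝ) (y : Fin m → ℝ)
    (hy : y ∈ Set.extremePoints ℝ (cutCube m c)) (i j : Fin m) (hij : i ≠ j)
    (hi : 0 < y i ∧ y i < c) (hj : 0 < y j ∧ y j < c) : False := by
  rw [mem_extremePoints] at hy
  obtain ⟨⟨hb, hs⟩, hext⟩ := hy
  obtain ⟨e, he, h1, h2, h3, h4⟩ : ∃ e : ℝ, 0 < e ∧ e ≤ y i ∧ e ≤ c - y i ∧ e ≤ y j ∧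
      e ≤ c - y j := by
    refine ⟨min (min (y i) (c - y i)) (min (y j) (c - y j)), ?_, ?_, ?_, ?_, ?_⟩
    · simp only [lt_min_iff]
      refine ⟨⟨?_, ?_⟩, ?_, ?_⟩ <;> linarith
    all_goals simp
  have hmem : ∀ t : ℝ, |t| ≤ e → y + t • (Pi.single i 1 - Pi.single j 1) ∈ cutCube m c := by
    intro t ht
    rw [abs_le] at ht
    refine ⟨fun l => ?_, ?_⟩
    · have := hb l
      by_cases hli : l = i
      · subst hli
        simp [hij]
        constructor <;> linarith
      · by_cases hlj : l = j
        · subst hlj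
          simp [hli]
          constructor <;> linarith
        · simpa [hli, hlj] using this
    · simp [Finset.sum_add_distrib, ← Finset.mul_sum, hs]
  have hx := hext _ (hmem e (abs_of_pos he).le) _ (hmem (-e) (by rw [abs_neg, abs_of_pos he]))
    ⟨1 / 2, 1 / 2, by norm_num, by norm_num, by norm_num, by
      funext l
      simp only [Pi.add_apply, Pi.smul_apply, smul_eq_mul]
      ring⟩
  have := congrFun hx.1 i
  simp [hij] at this
  linarith

lemma extreme_vtx {m k : ℕ} (c : ℝ) (hc : 0 < c) (hkc : (k : ℝ) * c + c / 2 = 1)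
    (y : Fin m → ℝ) (hy : y ∈ Set.extremePoints ℝ (cutCube m c)) :
    ∃ (A : Finset (Fin m)) (j : Fin m), j ∉ A ∧ A.card = k ∧ vtx c A j = y := by
  classical
  have hyP := hy.1
  obtain ⟨hb, hs⟩ := hyP
  set A : Finset (Fin m) := Finset.univ.filter (fun i => y i = c) with hAdef
  have hmA : ∀ i, i ∈ A ↔ y i = c := by intro i; simp [hAdef]
  have hex : ∃ j, 0 < y j ∧ y j < c := by
    by_contra hno
    have h : ∀ i, y i = if i ∈ A then c else 0 := by
      intro i
      by_cases h1 : y i = c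
      · simp [hmA, h1]
      · rw [if_neg (by simpa [hmA] using h1)]
        by_contra h0
        exact hno ⟨i, lt_of_le_of_ne (hb i).1 (Ne.symm h0), lt_of_le_of_ne (hb i).2 h1⟩
    rw [Finset.sum_congr rfl (fun i _ => h i)] at hs
    simp only [Finset.sum_ite_mem, Finset.univ_inter, Finset.sum_const, nsmul_eq_mul] at hs
    have h3 : ((A.card : ℝ) - k - 1 / 2) * c = 0 := by linarith
    have h4 : (A.card : ℝ) - k - 1 / 2 = 0 := by
      rcases mul_eq_zero.1 h3 with h | h
      · exact h
      · exact absurd h hc.ne'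
    have h5 : (2 * A.card : ℝ) = 2 * k + 1 := by linarith
    have h6 : 2 * A.card = 2 * k + 1 := by exact_mod_cast h5
    omega
  obtain ⟨j, hj0, hjc⟩ := hex
  have hjA : j ∉ A := by rw [hmA]; exact hjc.ne
  have h : ∀ i, y i = (if i ∈ A then c else 0) + if i = j then y j else 0 := by
    intro i
    by_cases hij : i = j
    · subst hij; simp [hjA]
    · by_cases h1 : y i = c
      · simp [hmA, h1, hij]
      · rw [if_neg (by simpa [hmA] using h1), if_neg hij]
        by_contra h0
        refine frac_unique c y hy i j hij ⟨lt_of_le_of_ne (hb i).1 ?_,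
          lt_of_le_of_ne (hb i).2 h1⟩ ⟨hj0, hjc⟩
        intro h; apply h0; linarith
  have hs2 : (A.card : ℝ) * c + y j = 1 := by
    rw [Finset.sum_congr rfl (fun i _ => h i), Finset.sum_add_distrib] at hs
    simpa using hs
  have hcard : A.card = k := by
    have h1 : A.card < k + 1 := by
      by_contra hlt
      have : ((k + 1 : ℕ) : ℝ) ≤ A.card := by exact_mod_cast not_lt.1 hlt
      push_cast at this
      nlinarith
    have h2 : k < A.card + 1 := by
      by_contra hlt
      have : ((A.card + 1 : ℕ) : ℝ) ≤ k := by exact_mod_cast not_lt.1 hlt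
      push_cast at this
      nlinarith
    omega
  have hyj : y j = c / 2 := by rw [hcard] at hs2; linarith
  refine ⟨A, j, hjA, hcard, ?_⟩
  funext i
  rw [h i, hyj]
  unfold vtx
  by_cases h1 : i ∈ A
  · have : i ≠ j := fun h => hjA (h ▸ h1)
    simp [h1, this]
  · simp [h1]

lemma vtx_inj {m : ℕ} (c : ℝ) (hc : 0 < c) (A B : Finset (Fin m)) (i j : Fin m)
    (hi : i ∉ A) (hj : j ∉ B) (h : vtx c A i = vtx c B j) : A = B ∧ i = j := by
  have hA : ∀ (A : Finset (Fin m)) (i l : Fin m), l ∈ A ↔ vtx c A i l = c := by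
    intro A i l
    unfold vtx
    split_ifs with h1 h2
    · simp [h1]
    · simp only [h1, false_iff]; intro h; linarith
    · simp only [h1, false_iff]; exact hc.ne
  have hAB : A = B := by
    ext l
    rw [hA A i, hA B j, h]
  refine ⟨hAB, ?_⟩
  subst hAB
  by_contra hij
  have := congrFun h i
  simp [vtx, hi, hij] at this
  linarith

/-- The bound `n * C(m, n)` is best possible: for `S` the standard unit vectors
of `ℝ^m` and all intervals equal to `[0, 2/(2(m-n)+1)]`, the convex interval
hull has exactly `n * C(m, n)` vertices (extreme points). -/
theorem convex_interval_hull_vertex_bound_sharp (m n : ℕ) (hn : n = m / 2 + 1) :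
    (Set.extremePoints ℝ {y : Fin m → ℝ | ∃ ξ : Fin m → ℝ,
        (∀ j, ξ j ∈ Set.Icc (0 : ℝ) (2 / (2 * ((m - n : ℕ) : ℝ) + 1))) ∧
        (∑ j, ξ j) = 1 ∧
        y = ∑ j, ξ j • (Pi.single j 1 : Fin m → ℝ)}).ncard = n * Nat.choose m n := by
  classical
  obtain ⟨k, hk⟩ : ∃ k, k = m - n := ⟨_, rfl⟩
  rw [← hk]
  obtain ⟨c, hcdef⟩ : ∃ c : ℝ, c = 2 / (2 * (k : ℝ) + 1) := ⟨_, rfl⟩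
  rw [← hcdef]
  have hkpos : (0 : ℝ) < 2 * (k : ℝ) + 1 := by positivity
  have hc : 0 < c := by rw [hcdef]; positivity
  have hkc : (k : ℝ) * c + c / 2 = 1 := by rw [hcdef]; field_simp
  have hset : {y : Fin m → ℝ | ∃ ξ : Fin m → ℝ,
        (∀ j, ξ j ∈ Set.Icc (0 : ℝ) c) ∧ (∑ j, ξ j) = 1 ∧
        y = ∑ j, ξ j • (Pi.single j 1 : Fin m → ℝ)} = cutCube m c := by
    have hid : ∀ ξ : Fin m → ℝ, ∑ j, ξ j • (Pi.single j 1 : Fin m → ℝ) = ξ := by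
      intro ξ
      exact (pi_eq_sum_univ' ξ).symm ▸ (by
        funext i
        simp [Finset.sum_apply, Pi.single_apply])
    ext y
    constructor
    · rintro ⟨ξ, h1, h2, rfl⟩
      rw [hid]
      exact ⟨h1, h2⟩
    · rintro ⟨h1, h2⟩
      exact ⟨y, h1, h2, (hid y).symm⟩
  rw [hset]
  let T : Finset (Σ _ : Finset (Fin m), Fin m) :=
    (Finset.powersetCard k Finset.univ).sigma (fun A => Aᶜ)
  have himg : Set.extremePoints ℝ (cutCube m c) =
      Set.image (fun p : (Σ _ : Finset (Fin m), Fin m) => vtx c p.1 p.2)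
        (T : Set (Σ _ : Finset (Fin m), Fin m)) := by
    ext y
    constructor
    · intro hy
      obtain ⟨A, j, hj, hA, h⟩ := extreme_vtx c hc hkc y hy
      exact ⟨⟨A, j⟩, by simp [T, hA, hj], h⟩
    · rintro ⟨⟨A, j⟩, hp, rfl⟩
      simp [T] at hp
      exact vtx_extreme c hc hkc A j hp.2 hp.1
  rw [himg, Set.InjOn.ncard_image, Set.ncard_coe_finset]
  · simp only [T, Finset.card_sigma]
    rw [Finset.sum_congr rfl (g := fun _ => m - k) (by
      intro A hA
      rw [Finset.mem_powersetCard] at hA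
      rw [Finset.card_compl, hA.2, Fintype.card_fin])]
    rw [Finset.sum_const, Finset.card_powersetCard, Finset.card_univ, Fintype.card_fin, smul_eq_mul]
    rcases Nat.eq_zero_or_pos m with h0 | h0
    · subst h0
      subst hn
      simp
    · have hnm : n ≤ m := by omega
      rw [hk, Nat.choose_symm hnm, Nat.sub_sub_self hnm, mul_comm]
  · rintro ⟨A, i⟩ hA ⟨B, j⟩ hB h
    simp [T] at hA hB
    obtain ⟨rfl, rfl⟩ := vtx_inj c hc A B i j hA.2 hB.2 h
    rfl
end

section
/- Let I_j = [a_j, b_j], j = 1, …, m, with a_j < b_j < 1 − α + a_j for all j and α = Σ_{j=1}^m a_j < 1, and assume the family 𝒥_S is wide. Then co(S, 𝒥_S) is the convex hull of at most m(m−1) points; that is, there exists a finite set F ⊆ L with at most m(m−1) elements such that co(S, 𝒥_S) = conv F. -/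
/-- The polytope of admissible coefficient vectors. -/
def coefSet {m : ℕ} (a b : Fin m → ℝ) : Set (Fin m → ℝ) :=
  {ξ | (∀ j, ξ j ∈ Set.Icc (a j) (b j)) ∧ (∑ j, ξ j) = 1}

/-- The candidate vertices. -/
noncomputable def vert {m : ℕ} (a b : Fin m → ℝ) (p : Fin m × Fin m) : Fin m → ℝ :=
  a + Pi.single p.1 (b p.1 - a p.1) + Pi.single p.2 (1 - ∑ i, a i - (b p.1 - a p.1))

lemma coefSet_convex {m : ℕ} (a b : Fin m → ℝ) : Convex ℝ (coefSet a b) := by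
  rintro ξ ⟨h1, h2⟩ η ⟨h3, h4⟩ s t hs ht hst
  refine ⟨fun j => ?_, ?_⟩
  · exact (convex_Icc (a j) (b j)) (h1 j) (h3 j) hs ht hst
  · simp [Finset.sum_add_distrib, ← Finset.mul_sum, h2, h4, hst]

lemma coefSet_compact {m : ℕ} (a b : Fin m → ℝ) : IsCompact (coefSet a b) := by
  have h : coefSet a b = Set.Icc a b ∩ {ξ | (∑ j, ξ j) = 1} := by
    ext ξ
    simp [coefSet, Pi.le_def, forall_and]
  rw [h]
  exact isCompact_Icc.inter_right (isClosed_eq (by fun_prop) (by fun_prop))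

lemma extreme_not_two {m : ℕ} (a b ξ : Fin m → ℝ)
    (hξ : ξ ∈ (coefSet a b).extremePoints ℝ) (i j : Fin m) (hij : i ≠ j)
    (h1 : a i < ξ i) (h2 : ξ i < b i) (h3 : a j < ξ j) (h4 : ξ j < b j) : False := by
  obtain ⟨⟨hI, hS⟩, hext⟩ := hξ
  obtain ⟨e, he, he1, he2, he3, he4⟩ : ∃ e : ℝ, 0 < e ∧ e ≤ ξ i - a i ∧ e ≤ b i - ξ i ∧
      e ≤ ξ j - a j ∧ e ≤ b j - ξ j := by
    refine ⟨min (min (ξ i - a i) (b i - ξ i)) (min (ξ j - a j) (b j - ξ j)), ?_, ?_, ?_, ?_, ?_⟩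
    · simp [h1, h2, h3, h4]
    all_goals simp
  have key : ∀ s : ℝ, |s| ≤ e → ξ + (Pi.single i s - Pi.single j s) ∈ coefSet a b := by
    intro s hs
    obtain ⟨hs1, hs2⟩ := abs_le.1 hs
    refine ⟨fun k => ?_, ?_⟩
    · have := hI k
      simp only [Set.mem_Icc, Pi.add_apply, Pi.sub_apply, Pi.single_apply] at this ⊢
      by_cases hki : k = i
      · subst hki
        simp only [hij, if_true, if_false]
        constructor <;> linarith
      · by_cases hkj : k = j
        · subst hkj
          simp only [hki, if_true, if_false]
          constructor <;> linarith
        · simpa [hki, hkj] using this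
    · simp [Finset.sum_add_distrib, hS]
  have hp := key e (by rw [abs_of_pos he])
  have hm := key (-e) (by rw [abs_neg, abs_of_pos he])
  have := hext hp hm ⟨1/2, 1/2, by norm_num, by norm_num, by norm_num, by
    ext k
    simp only [Pi.add_apply, Pi.sub_apply, Pi.smul_apply, smul_eq_mul, Pi.single_neg,
      Pi.neg_apply]
    ring⟩
  have h := congrFun this i
  simp [Pi.single_apply, hij] at h
  linarith

lemma coefSet_eq {m : ℕ} (a b : Fin m → ℝ) (hab : ∀ j, a j < b j)
    (hb : ∀ j, b j < 1 - (∑ i, a i) + a j) (hα : (∑ i, a i) < 1)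
    (hwide : ∀ k j, k ≠ j → (b k - a k) + (b j - a j) > 1 - ∑ i, a i) :
    coefSet a b = convexHull ℝ (vert a b '' (Finset.univ.offDiag : Finset (Fin m × Fin m))) := by
  apply Set.Subset.antisymm
  · have hfin : (vert a b '' (Finset.univ.offDiag : Finset (Fin m × Fin m))).Finite :=
      (Finset.finite_toSet _).image _
    rw [← closure_convexHull_extremePoints (coefSet_compact a b) (coefSet_convex a b)]
    refine closure_minimal (convexHull_mono ?_) (hfin.isClosed_convexHull ℝ)
    intro ξ hξ
    have htwo := extreme_not_two a b ξ hξ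
    obtain ⟨⟨hI, hS⟩, -⟩ := hξ
    have hD : ∑ i, (ξ i - a i) = 1 - ∑ i, a i := by rw [Finset.sum_sub_distrib, hS]
    have hone : ∀ i, (∀ j, j ≠ i → ξ j = a j) → ξ i - a i = 1 - ∑ i, a i := by
      intro i h
      rw [← hD, Fintype.sum_eq_single i]
      intro j hj
      rw [h j hj, sub_self]
    have hnotall : ∀ i, ∃ j, j ≠ i ∧ a j < ξ j := by
      intro i
      by_contra! h
      have := hone i (fun j hj => le_antisymm (h j hj) (hI j).1)
      linarith [hb i, (hI i).2]
    have hlt : ∀ k i, k ≠ i → ξ k = b k → ξ i < b i := by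
      intro k i hki hk
      by_contra! h
      have := Finset.add_le_sum (f := fun i => ξ i - a i) (s := Finset.univ)
        (fun i _ => sub_nonneg.2 (hI i).1) (Finset.mem_univ k) (Finset.mem_univ i) hki
      have := hwide k i hki
      linarith
    have hk : ∃ k, ξ k = b k := by
      by_contra! h
      have h' : ∀ k, ξ k < b k := fun k => lt_of_le_of_ne (hI k).2 (h k)
      obtain ⟨i, hi⟩ : ∃ i, a i < ξ i := by
        by_contra! h2
        have := Finset.sum_le_sum (fun i (_ : i ∈ Finset.univ) => h2 i)
        linarith
      obtain ⟨j, hj, hj'⟩ := hnotall i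
      exact htwo j i hj hj' (h' j) hi (h' i)
    obtain ⟨k, hk⟩ := hk
    obtain ⟨j, hjk, hj⟩ := hnotall k
    have hrest : ∀ i, i ≠ k ∧ i ≠ j → ξ i - a i = 0 := by
      rintro i ⟨hik, hij⟩
      by_contra h
      have h1 : a i < ξ i := lt_of_le_of_ne (hI i).1 (fun h' => h (by linarith))
      exact htwo i j hij h1 (hlt k i hik.symm hk) hj (hlt k j hjk.symm hk)
    have hsum := Fintype.sum_eq_add (f := fun i => ξ i - a i) k j hjk.symm hrest
    refine ⟨(k, j), by simpa using hjk.symm, ?_⟩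
    ext i
    simp only [vert, Pi.add_apply, Pi.single_apply]
    by_cases hik : i = k
    · subst hik
      simp [hjk.symm, hk]
    · by_cases hij : i = j
      · subst hij
        simp only [hik, if_true, if_false]
        linarith
      · simp only [hik, hij, if_false]
        linarith [hrest i ⟨hik, hij⟩]
  · refine convexHull_min ?_ (coefSet_convex a b)
    rintro _ ⟨⟨k, j⟩, hkj, rfl⟩
    have hkj : k ≠ j := by simpa using hkj
    refine ⟨fun i => ?_, ?_⟩
    · simp only [vert, Pi.add_apply, Pi.single_apply, Set.mem_Icc]
      have h1 := hab i
      have h2 := hb k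
      have h3 := hwide k j hkj
      by_cases hik : i = k
      · subst hik
        simp [hkj, h1.le]
      · by_cases hij : i = j
        · subst hij
          simp only [hik, if_true, if_false]
          constructor <;> linarith
        · simp [hik, hij, h1.le]
    · simp [vert, Finset.sum_add_distrib]

/-- For a wide family of intervals, the convex interval hull is the convex hull
of at most `m * (m - 1)` points. -/
theorem convex_interval_hull_wide_vertex_bound {L : Type*} [AddCommGroup L]
    [Module ℝ L] (m : ℕ) (x : Fin m → L) (hx : Function.Injective x)
    (a b : Fin m → ℝ) (hab : ∀ j, a j < b j)
    (hb : ∀ j, b j < 1 - (∑ i, a i) + a j) (hα : (∑ i, a i) < 1)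
    (hwide : ∀ k j, k ≠ j → (b k - a k) + (b j - a j) > 1 - ∑ i, a i) :
    ∃ F : Finset L, F.card ≤ m * (m - 1) ∧
      {y : L | ∃ ξ : Fin m → ℝ,
        (∀ j, ξ j ∈ Set.Icc (a j) (b j)) ∧ (∑ j, ξ j) = 1 ∧ y = ∑ j, ξ j • x j} =
      convexHull ℝ (F : Set L) := by
  classical
  refine ⟨(Finset.univ.offDiag : Finset (Fin m × Fin m)).image
    (fun p => Fintype.linearCombination ℝ x (vert a b p)), ?_, ?_⟩
  · refine Finset.card_image_le.trans ?_
    rw [Finset.offDiag_card]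
    simp [Nat.mul_sub]
  · rw [Finset.coe_image, ← Set.image_image (Fintype.linearCombination ℝ x) (vert a b),
      ← LinearMap.image_convexHull, ← coefSet_eq a b hab hb hα hwide]
    ext y
    simp only [Set.mem_setOf_eq, Set.mem_image, coefSet, Fintype.linearCombination_apply,
      and_assoc, eq_comm (a := y)]
end

section
/- Let 𝒥 = {I₁, …, I_m} with I_j = [a_j, b_j] (a_j ≤ b_j) be bounded closed intervals, α = Σ a_j, β = Σ b_j, and assume α ≤ 1 ≤ β. For each k ∈ {1, …, m}, the projection of the set (I₁ × ⋯ × I_m) ∩ Π₁ ⊆ ℝ^m onto the k-th coordinate axis equals the interval [â_k, b̂_k], where â_k = max{a_k, b_k − (β − 1)} and b̂_k = min{b_k, a_k + (1 − α)}. -/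
/-- The projection of `(I₁ × ⋯ × I_m) ∩ Π₁` onto the `k`-th coordinate axis is
the interval `[max{a_k, b_k - (β - 1)}, min{b_k, a_k + (1 - α)}]`. -/
theorem convex_interval_hull_projection (m : ℕ) (a b : Fin m → ℝ)
    (hab : ∀ j, a j ≤ b j) (hα : (∑ j, a j) ≤ 1) (hβ : (1 : ℝ) ≤ ∑ j, b j)
    (k : Fin m) :
    (fun p : Fin m → ℝ => p k) ''
        {p : Fin m → ℝ | (∀ j, p j ∈ Set.Icc (a j) (b j)) ∧ (∑ j, p j) = 1} =
      Set.Icc (max (a k) (b k - ((∑ j, b j) - 1)))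
        (min (b k) (a k + (1 - ∑ j, a j))) := by
  have hs : ∀ f : Fin m → ℝ, ∑ j, f j = f k + ∑ j ∈ Finset.univ.erase k, f j := fun f =>
    (Finset.add_sum_erase _ f (Finset.mem_univ k)).symm
  ext x
  simp only [Set.mem_image, Set.mem_setOf_eq, Set.mem_Icc, max_le_iff, le_min_iff]
  rw [hs a] at *
  rw [hs b] at *
  constructor
  · rintro ⟨p, ⟨hp, hsum⟩, rfl⟩
    rw [hs p] at hsum
    have h1 : ∑ j ∈ Finset.univ.erase k, a j ≤ ∑ j ∈ Finset.univ.erase k, p j :=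
      Finset.sum_le_sum fun j _ => (hp j).1
    have h2 : ∑ j ∈ Finset.univ.erase k, p j ≤ ∑ j ∈ Finset.univ.erase k, b j :=
      Finset.sum_le_sum fun j _ => (hp j).2
    refine ⟨⟨(hp k).1, ?_⟩, (hp k).2, ?_⟩ <;> linarith
  · rintro ⟨⟨h1, h2⟩, h3, h4⟩
    obtain ⟨t, ht0, ht1, ht⟩ : ∃ t : ℝ, 0 ≤ t ∧ t ≤ 1 ∧
        ∑ j ∈ Finset.univ.erase k, a j + t * (∑ j ∈ Finset.univ.erase k, b j -
          ∑ j ∈ Finset.univ.erase k, a j) = 1 - x := by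
      generalize ∑ j ∈ Finset.univ.erase k, a j = A at *
      generalize ∑ j ∈ Finset.univ.erase k, b j = B at *
      rcases eq_or_lt_of_le (show A ≤ B by linarith) with h | h
      · exact ⟨0, le_rfl, zero_le_one, by linarith⟩
      · have hd : 0 < B - A := by linarith
        refine ⟨(1 - x - A) / (B - A), div_nonneg (by linarith) hd.le, ?_, ?_⟩
        · rw [div_le_one hd]; linarith
        · rw [div_mul_cancel₀ _ hd.ne']; ring
    refine ⟨fun j => if j = k then x else a j + t * (b j - a j), ⟨fun j => ?_, ?_⟩, by simp⟩
    · by_cases hj : j = k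
      · subst hj; simp [h1, h3]
      · have := hab j
        simp only [hj, if_false]
        constructor <;> nlinarith
    · rw [hs]
      have : ∑ j ∈ Finset.univ.erase k, (if j = k then x else a j + t * (b j - a j)) =
          ∑ j ∈ Finset.univ.erase k, (a j + t * (b j - a j)) :=
        Finset.sum_congr rfl fun j hj => if_neg (Finset.ne_of_mem_erase hj)
      rw [this, Finset.sum_add_distrib, ← Finset.mul_sum, Finset.sum_sub_distrib, ht]
      simp
end

section
/- Let 𝒥 = {I₁, …, I_m} with I_j = [a_j, b_j] (a_j ≤ b_j) be bounded closed intervals, α = Σ a_j, β = Σ b_j, and assume α ≤ 1 ≤ β. Then (Î₁ × ⋯ × Î_m) ∩ Π₁ = (I₁ × ⋯ × I_m) ∩ Π₁. -/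
/-- `(Î₁ × ⋯ × Î_m) ∩ Π₁ = (I₁ × ⋯ × I_m) ∩ Π₁`, where
`Î_j = [max{a_j, b_j - (β - 1)}, min{b_j, a_j + (1 - α)}]`. -/
theorem convex_interval_hull_hat_inter (m : ℕ) (a b : Fin m → ℝ)
    (hab : ∀ j, a j ≤ b j) (hα : (∑ j, a j) ≤ 1) (hβ : (1 : ℝ) ≤ ∑ j, b j) :
    {p : Fin m → ℝ | (∀ j, p j ∈
        Set.Icc (max (a j) (b j - ((∑ i, b i) - 1)))
          (min (b j) (a j + (1 - ∑ i, a i)))) ∧ (∑ j, p j) = 1} =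
      {p : Fin m → ℝ | (∀ j, p j ∈ Set.Icc (a j) (b j)) ∧ (∑ j, p j) = 1} := by
  ext p
  simp only [Set.mem_setOf_eq, Set.mem_Icc, max_le_iff, le_min_iff]
  constructor
  · rintro ⟨h, hs⟩
    exact ⟨fun j => ⟨(h j).1.1, (h j).2.1⟩, hs⟩
  · rintro ⟨h, hs⟩
    refine ⟨fun j => ?_, hs⟩
    have h1 : b j - p j ≤ ∑ i, (b i - p i) :=
      Finset.single_le_sum (f := fun i => b i - p i)
        (fun i _ => sub_nonneg.2 (h i).2) (Finset.mem_univ j)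
    have h2 : p j - a j ≤ ∑ i, (p i - a i) :=
      Finset.single_le_sum (f := fun i => p i - a i)
        (fun i _ => sub_nonneg.2 (h i).1) (Finset.mem_univ j)
    rw [Finset.sum_sub_distrib, hs] at h1 h2
    exact ⟨⟨(h j).1, by linarith⟩, (h j).2, by linarith⟩
end

section
/- Let 𝒥 = {I₁, …, I_m} with I_j = [a_j, b_j] (a_j ≤ b_j) be bounded closed intervals, α = Σ a_j, β = Σ b_j, and assume α ≤ 1 ≤ β. Then the associated family 𝒥̂ = {Î₁, …, Î_m} is irreducible; that is, setting α̂ = Σ â_j and β̂ = Σ b̂_j, one has b̂_k − â_k ≤ min{1 − α̂, β̂ − 1} for every k = 1, …, m. -/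
lemma hat_s1 (x y q : ℝ) : max x (y - q) = x + max 0 (y - x - q) := by grind

lemma hat_s2 (x y p : ℝ) : min y (x + p) = y - max 0 (y - x - p) := by grind

lemma hat_s3 (x y p : ℝ) : min y (x + p) = x + min (y - x) p := by grind

lemma hat_s4 (x y q : ℝ) : max x (y - q) = y - min (y - x) q := by grind

lemma hat_aux {m : ℕ} (l : Fin m → ℝ) (p q : ℝ) (hl : ∀ j, 0 ≤ l j) (hq : 0 ≤ q)
    (hs : ∑ j, l j = p + q) (k : Fin m) :
    min (l k) p - max 0 (l k - q) + ∑ j, max 0 (l j - q) ≤ p := by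
  have e1 := Finset.add_sum_erase Finset.univ (fun j => max 0 (l j - q)) (Finset.mem_univ k)
  have e2 := Finset.add_sum_erase Finset.univ l (Finset.mem_univ k)
  by_cases h : ∃ j ∈ Finset.univ.erase k, q < l j
  · obtain ⟨j, hj, hlt⟩ := h
    have e3 := Finset.add_sum_erase _ (fun j => max 0 (l j - q)) hj
    have e4 := Finset.add_sum_erase _ l hj
    have e5 : ∑ i ∈ (Finset.univ.erase k).erase j, max 0 (l i - q)
        ≤ ∑ i ∈ (Finset.univ.erase k).erase j, l i :=
      Finset.sum_le_sum fun i _ => max_le (hl i) (by linarith)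
    rw [max_eq_right (by linarith : (0 : ℝ) ≤ l j - q)] at e3
    linarith [min_le_left (l k) p]
  · push Not at h
    have : ∑ j ∈ Finset.univ.erase k, max 0 (l j - q) = 0 :=
      Finset.sum_eq_zero fun i hi => max_eq_left (by linarith [h i hi])
    linarith [min_le_right (l k) p]

/-- The associated family `𝒥̂` of a family of bounded closed intervals with
`α ≤ 1 ≤ β` is irreducible. -/
theorem convex_interval_hull_hat_irreducible (m : ℕ) (a b : Fin m → ℝ)
    (hab : ∀ j, a j ≤ b j) (hα : (∑ j, a j) ≤ 1) (hβ : (1 : ℝ) ≤ ∑ j, b j)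
    (ahat bhat : Fin m → ℝ)
    (hahat : ∀ j, ahat j = max (a j) (b j - ((∑ i, b i) - 1)))
    (hbhat : ∀ j, bhat j = min (b j) (a j + (1 - ∑ i, a i))) :
    ∀ k, bhat k - ahat k ≤ min (1 - ∑ j, ahat j) ((∑ j, bhat j) - 1) := by
  intro k
  have hl : ∀ j, 0 ≤ b j - a j := fun j => sub_nonneg.2 (hab j)
  have hs : ∑ j, (b j - a j) = (∑ j, b j) - ∑ j, a j := Finset.sum_sub_distrib ..
  generalize hA : ∑ j, a j = A at *
  generalize hB : ∑ j, b j = B at *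
  have h1 := hat_aux (fun j => b j - a j) (1 - A) (B - 1) hl (by linarith)
    (by rw [hs]; ring) k
  have h2 := hat_aux (fun j => b j - a j) (B - 1) (1 - A) hl (by linarith)
    (by rw [hs]; ring) k
  have ea : ∀ j, ahat j = a j + max 0 (b j - a j - (B - 1)) := by
    intro j; rw [hahat]; exact hat_s1 _ _ _
  have eb : ∀ j, bhat j = b j - max 0 (b j - a j - (1 - A)) := by
    intro j; rw [hbhat]; exact hat_s2 _ _ _
  have sa : ∑ j, ahat j = A + ∑ j, max 0 (b j - a j - (B - 1)) := by
    rw [← hA, ← Finset.sum_add_distrib]; exact Finset.sum_congr rfl fun j _ => ea j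
  have sb : ∑ j, bhat j = B - ∑ j, max 0 (b j - a j - (1 - A)) := by
    rw [← hB, ← Finset.sum_sub_distrib]
    exact Finset.sum_congr rfl fun j _ => eb j
  have f1 : bhat k = a k + min (b k - a k) (1 - A) := by rw [hbhat]; exact hat_s3 _ _ _
  have f2 : ahat k = b k - min (b k - a k) (B - 1) := by rw [hahat]; exact hat_s4 _ _ _
  apply le_min
  · linarith [ea k]
  · linarith [eb k]
end

section
/- Let 𝒥_S consist of bounded closed intervals I_j = [a_j, b_j] and suppose co(S, 𝒥_S) ≠ ∅. Then co(S, 𝒥̂_S) = co(S, 𝒥_S), where 𝒥̂_S is the associated family of intervals Î_j = [â_j, b̂_j] with â_j = max{a_j, b_j − (β − 1)}, b̂_j = min{b_j, a_j + (1 − α)}, α = Σ a_j, β = Σ b_j. -/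
/-- If the convex interval hull is nonempty, then replacing the family of
intervals by the associated family `𝒥̂` does not change the hull. -/
theorem convex_interval_hull_hat_eq {L : Type*} [AddCommGroup L] [Module ℝ L]
    (m : ℕ) (x : Fin m → L) (a b : Fin m → ℝ) (hab : ∀ j, a j ≤ b j)
    (hne : ({y : L | ∃ ξ : Fin m → ℝ,
      (∀ j, ξ j ∈ Set.Icc (a j) (b j)) ∧ (∑ j, ξ j) = 1 ∧
        y = ∑ j, ξ j • x j}).Nonempty) :
    {y : L | ∃ ξ : Fin m → ℝ,
        (∀ j, ξ j ∈ Set.Icc (max (a j) (b j - ((∑ i, b i) - 1)))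
          (min (b j) (a j + (1 - ∑ i, a i)))) ∧ (∑ j, ξ j) = 1 ∧
        y = ∑ j, ξ j • x j} =
      {y : L | ∃ ξ : Fin m → ℝ,
        (∀ j, ξ j ∈ Set.Icc (a j) (b j)) ∧ (∑ j, ξ j) = 1 ∧
        y = ∑ j, ξ j • x j} := by
  ext y
  constructor
  · rintro ⟨ξ, h, h1, hy⟩
    exact ⟨ξ, fun j => ⟨(le_max_left _ _).trans (h j).1, (h j).2.trans (min_le_left _ _)⟩, h1, hy⟩
  · rintro ⟨ξ, h, h1, hy⟩
    refine ⟨ξ, fun j => ⟨max_le (h j).1 ?_, le_min (h j).2 ?_⟩, h1, hy⟩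
    · have := Finset.single_le_sum (f := fun i => b i - ξ i)
        (fun i _ => sub_nonneg.2 (h i).2) (Finset.mem_univ j)
      simp only [Finset.sum_sub_distrib, h1] at this
      linarith
    · have := Finset.single_le_sum (f := fun i => ξ i - a i)
        (fun i _ => sub_nonneg.2 (h i).1) (Finset.mem_univ j)
      simp only [Finset.sum_sub_distrib, h1] at this
      linarith
end

section
/- Let 𝒥_S consist of bounded closed intervals I_j = [a_j, b_j] and suppose co(S, 𝒥_S) ≠ ∅. If 𝒥_S is a minimal interval family for S, then 𝒥_S is irreducible, i.e., b_k − a_k ≤ min{1 − α, β − 1} for every k, where α = Σ a_j and β = Σ b_j. -/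
/-- If a family of bounded closed intervals with nonempty convex interval hull
is minimal for `S`, then it is irreducible. -/
theorem minimal_implies_irreducible {L : Type*} [AddCommGroup L] [Module ℝ L]
    (m : ℕ) (x : Fin m → L) (a b : Fin m → ℝ) (hab : ∀ j, a j ≤ b j)
    (hne : ({y : L | ∃ ξ : Fin m → ℝ,
      (∀ j, ξ j ∈ Set.Icc (a j) (b j)) ∧ (∑ j, ξ j) = 1 ∧
        y = ∑ j, ξ j • x j}).Nonempty)
    (hmin : ∀ a' b' : Fin m → ℝ, (∀ j, a' j ≤ b' j) →
      (∀ j, Set.Icc (a' j) (b' j) ⊆ Set.Icc (a j) (b j)) →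
      {y : L | ∃ ξ : Fin m → ℝ,
        (∀ j, ξ j ∈ Set.Icc (a' j) (b' j)) ∧ (∑ j, ξ j) = 1 ∧
          y = ∑ j, ξ j • x j} =
      {y : L | ∃ ξ : Fin m → ℝ,
        (∀ j, ξ j ∈ Set.Icc (a j) (b j)) ∧ (∑ j, ξ j) = 1 ∧
          y = ∑ j, ξ j • x j} →
      ∀ j, Set.Icc (a' j) (b' j) = Set.Icc (a j) (b j)) :
    ∀ k, b k - a k ≤ min (1 - ∑ j, a j) ((∑ j, b j) - 1) := by
  intro k
  obtain ⟨y, η, hη, hη1, -⟩ := hne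
  have key1 : ∀ ξ : Fin m → ℝ, (∀ j, ξ j ∈ Set.Icc (a j) (b j)) → (∑ j, ξ j) = 1 →
      ξ k - a k ≤ 1 - ∑ j, a j := by
    intro ξ h h1
    rw [← h1, ← Finset.sum_sub_distrib]
    exact Finset.single_le_sum (f := fun j => ξ j - a j)
      (fun j _ => sub_nonneg.2 (h j).1) (Finset.mem_univ k)
  have key2 : ∀ ξ : Fin m → ℝ, (∀ j, ξ j ∈ Set.Icc (a j) (b j)) → (∑ j, ξ j) = 1 →
      b k - ξ k ≤ (∑ j, b j) - 1 := by
    intro ξ h h1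
    rw [← h1, ← Finset.sum_sub_distrib]
    exact Finset.single_le_sum (f := fun j => b j - ξ j)
      (fun j _ => sub_nonneg.2 (h j).2) (Finset.mem_univ k)
  have hk := hη k
  have e1 := key1 η hη hη1
  have e2 := key2 η hη hη1
  have main : ∀ a' b' : Fin m → ℝ, (∀ j, a' j ≤ b' j) → (∀ j, a j ≤ a' j) →
      (∀ j, b' j ≤ b j) →
      (∀ ξ : Fin m → ℝ, (∀ j, ξ j ∈ Set.Icc (a j) (b j)) → (∑ j, ξ j) = 1 →
        ∀ j, ξ j ∈ Set.Icc (a' j) (b' j)) → a' k = a k ∧ b' k = b k := by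
    intro a' b' h0 ha hb h
    have hs : ∀ j, Set.Icc (a' j) (b' j) ⊆ Set.Icc (a j) (b j) :=
      fun j => Set.Icc_subset_Icc (ha j) (hb j)
    have e := hmin a' b' h0 hs (by
      ext y
      constructor
      · rintro ⟨ξ, h1, h2, h3⟩
        exact ⟨ξ, fun j => hs j (h1 j), h2, h3⟩
      · rintro ⟨ξ, h1, h2, h3⟩
        exact ⟨ξ, h ξ h1 h2, h2, h3⟩) k
    have l : a k ∈ Set.Icc (a' k) (b' k) := e ▸ Set.left_mem_Icc.2 (hab k)
    have r : b k ∈ Set.Icc (a' k) (b' k) := e ▸ Set.right_mem_Icc.2 (hab k)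
    exact ⟨le_antisymm l.1 (ha k), le_antisymm (hb k) r.2⟩
  have hk1 := hk.1
  have hk2 := hk.2
  apply le_min
  · by_contra! hlt
    have := (main a (Function.update b k (a k + (1 - ∑ j, a j))) ?_ (fun j => le_rfl) ?_ ?_).2
    · rw [Function.update_self] at this
      linarith
    · intro j
      rcases eq_or_ne j k with rfl | hj
      · rw [Function.update_self]; linarith
      · rw [Function.update_of_ne hj]; exact hab j
    · intro j
      rcases eq_or_ne j k with rfl | hj
      · rw [Function.update_self]; linarith
      · rw [Function.update_of_ne hj]
    · intro ξ h h1 j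
      rcases eq_or_ne j k with rfl | hj
      · rw [Function.update_self]
        exact ⟨(h j).1, by linarith [key1 ξ h h1]⟩
      · rw [Function.update_of_ne hj]; exact h j
  · by_contra! hlt
    have := (main (Function.update a k (b k - ((∑ j, b j) - 1))) b ?_ ?_ (fun j => le_rfl) ?_).1
    · rw [Function.update_self] at this
      linarith
    · intro j
      rcases eq_or_ne j k with rfl | hj
      · rw [Function.update_self]; linarith
      · rw [Function.update_of_ne hj]; exact hab j
    · intro j
      rcases eq_or_ne j k with rfl | hj
      · rw [Function.update_self]; linarith
      · rw [Function.update_of_ne hj]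
    · intro ξ h h1 j
      rcases eq_or_ne j k with rfl | hj
      · rw [Function.update_self]
        exact ⟨by linarith [key2 ξ h h1], (h j).2⟩
      · rw [Function.update_of_ne hj]; exact h j
end

section
/- Suppose the points x₁, …, x_m of S are affinely independent, the intervals I_j = [a_j, b_j] are bounded and closed, and co(S, 𝒥_S) ≠ ∅. Then 𝒥_S is a minimal interval family for S if and only if 𝒥_S is irreducible. -/
theorem exists_between_sum {m : ℕ} (c d : Fin m → ℝ) (h : ∀ j, c j ≤ d j)
    (hc : ∑ j, c j ≤ 1) (hd : 1 ≤ ∑ j, d j) :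
    ∃ ξ : Fin m → ℝ, (∀ j, ξ j ∈ Set.Icc (c j) (d j)) ∧ ∑ j, ξ j = 1 := by
  have hcont : ContinuousOn (fun t : ℝ => ∑ j, (c j + t * (d j - c j))) (Set.Icc 0 1) := by
    fun_prop
  have hiv := intermediate_value_Icc (zero_le_one' ℝ) hcont
  have h1 : (1 : ℝ) ∈ Set.Icc (∑ j, (c j + (0 : ℝ) * (d j - c j)))
      (∑ j, (c j + (1 : ℝ) * (d j - c j))) := by
    constructor
    · simpa using hc
    · simpa using hd
  obtain ⟨t, ht, hs⟩ := hiv h1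
  refine ⟨fun j => c j + t * (d j - c j), fun j => ⟨?_, ?_⟩, hs⟩
  · have := mul_nonneg ht.1 (sub_nonneg.2 (h j))
    linarith
  · have := mul_nonneg (sub_nonneg.2 ht.2) (sub_nonneg.2 (h j))
    linarith

theorem sum_update_real {m : ℕ} (f : Fin m → ℝ) (k : Fin m) (v : ℝ) :
    ∑ j, Function.update f k v j = ∑ j, f j - f k + v := by
  rw [Finset.sum_update_of_mem (Finset.mem_univ k),
    ← Finset.add_sum_erase _ f (Finset.mem_univ k), Finset.sdiff_singleton_eq_erase]
  ring

theorem coeff_unique {L : Type*} [AddCommGroup L] [Module ℝ L] {m : ℕ} {x : Fin m → L}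
    (hx : AffineIndependent ℝ x) (ξ η : Fin m → ℝ) (h1 : ∑ j, ξ j = 1) (h2 : ∑ j, η j = 1)
    (h : ∑ j, ξ j • x j = ∑ j, η j • x j) (k : Fin m) : ξ k = η k := by
  rw [affineIndependent_iff] at hx
  have := hx Finset.univ (fun j => ξ j - η j) (by simp [h1, h2])
    (by simp [sub_smul, h]) k (Finset.mem_univ k)
  exact sub_eq_zero.1 this

/-- For an affinely independent set `S`, a family of bounded closed intervals
with nonempty convex interval hull is minimal for `S` if and only if it is
irreducible. -/
theorem minimal_iff_irreducible {L : Type*} [AddCommGroup L] [Module ℝ L]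
    (m : ℕ) (x : Fin m → L) (hx : AffineIndependent ℝ x)
    (a b : Fin m → ℝ) (hab : ∀ j, a j ≤ b j)
    (hne : ({y : L | ∃ ξ : Fin m → ℝ,
      (∀ j, ξ j ∈ Set.Icc (a j) (b j)) ∧ (∑ j, ξ j) = 1 ∧
        y = ∑ j, ξ j • x j}).Nonempty) :
    (∀ a' b' : Fin m → ℝ, (∀ j, a' j ≤ b' j) →
      (∀ j, Set.Icc (a' j) (b' j) ⊆ Set.Icc (a j) (b j)) →
      {y : L | ∃ ξ : Fin m → ℝ,
        (∀ j, ξ j ∈ Set.Icc (a' j) (b' j)) ∧ (∑ j, ξ j) = 1 ∧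
          y = ∑ j, ξ j • x j} =
      {y : L | ∃ ξ : Fin m → ℝ,
        (∀ j, ξ j ∈ Set.Icc (a j) (b j)) ∧ (∑ j, ξ j) = 1 ∧
          y = ∑ j, ξ j • x j} →
      ∀ j, Set.Icc (a' j) (b' j) = Set.Icc (a j) (b j)) ↔
    (∀ k, b k - a k ≤ min (1 - ∑ j, a j) ((∑ j, b j) - 1)) := by
  constructor
  · intro hmin k
    obtain ⟨y, ξ₀, hξ₀, hs₀, -⟩ := hne
    have hα : ∑ j, a j ≤ 1 := hs₀ ▸ Finset.sum_le_sum fun j _ => (hξ₀ j).1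
    have hβ : 1 ≤ ∑ j, b j := hs₀ ▸ Finset.sum_le_sum fun j _ => (hξ₀ j).2
    refine le_min ?_ ?_
    · by_contra! hlt
      have hb' : ∀ j, Function.update b k (1 - ∑ j, a j + a k) j ≤ b j := by
        intro j
        by_cases hj : j = k
        · subst hj; simp; linarith
        · simp [hj]
      have hI := hmin a (Function.update b k (1 - ∑ j, a j + a k)) (by
        intro j
        by_cases hj : j = k
        · subst hj; simp; linarith
        · simp [hj, hab]) (fun j => Set.Icc_subset_Icc le_rfl (hb' j)) (by
        ext z
        constructor
        · rintro ⟨ξ, h, hs, hz⟩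
          exact ⟨ξ, fun j => ⟨(h j).1, (h j).2.trans (hb' j)⟩, hs, hz⟩
        · rintro ⟨ξ, h, hs, hz⟩
          refine ⟨ξ, fun j => ⟨(h j).1, ?_⟩, hs, hz⟩
          by_cases hj : j = k
          · subst hj
            have := Finset.single_le_sum (f := fun i => ξ i - a i)
              (fun i _ => sub_nonneg.2 (h i).1) (Finset.mem_univ j)
            simp only [Finset.sum_sub_distrib] at this
            simp only [Function.update_self]
            linarith
          · simpa [hj] using (h j).2) k
      have : b k ∈ Set.Icc (a k) (b k) := ⟨hab k, le_rfl⟩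
      rw [← hI] at this
      have := this.2
      simp only [Function.update_self] at this
      linarith
    · by_contra! hlt
      have ha' : ∀ j, a j ≤ Function.update a k (1 - ∑ j, b j + b k) j := by
        intro j
        by_cases hj : j = k
        · subst hj; simp; linarith
        · simp [hj]
      have hI := hmin (Function.update a k (1 - ∑ j, b j + b k)) b (by
        intro j
        by_cases hj : j = k
        · subst hj; simp; linarith
        · simp [hj, hab]) (fun j => Set.Icc_subset_Icc (ha' j) le_rfl) (by
        ext z
        constructor
        · rintro ⟨ξ, h, hs, hz⟩
          exact ⟨ξ, fun j => ⟨(ha' j).trans (h j).1, (h j).2⟩, hs, hz⟩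
        · rintro ⟨ξ, h, hs, hz⟩
          refine ⟨ξ, fun j => ⟨?_, (h j).2⟩, hs, hz⟩
          by_cases hj : j = k
          · subst hj
            have := Finset.single_le_sum (f := fun i => b i - ξ i)
              (fun i _ => sub_nonneg.2 (h i).2) (Finset.mem_univ j)
            simp only [Finset.sum_sub_distrib] at this
            simp only [Function.update_self]
            linarith
          · simpa [hj] using (h j).1) k
      have : a k ∈ Set.Icc (a k) (b k) := ⟨le_rfl, hab k⟩
      rw [← hI] at this
      have := this.1
      simp only [Function.update_self] at this
      linarith
  · intro hirr a' b' _ hsub heq k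
    have hk := hirr k
    have hk1 := hk.trans (min_le_left _ _)
    have hk2 := hk.trans (min_le_right _ _)
    have habk := hab k
    have key : ∀ ξ : Fin m → ℝ, (∀ j, ξ j ∈ Set.Icc (a j) (b j)) → ∑ j, ξ j = 1 →
        ξ k ∈ Set.Icc (a' k) (b' k) := by
      intro ξ h hs
      have hmem : (∑ j, ξ j • x j) ∈ {y : L | ∃ ξ : Fin m → ℝ,
        (∀ j, ξ j ∈ Set.Icc (a j) (b j)) ∧ (∑ j, ξ j) = 1 ∧
          y = ∑ j, ξ j • x j} := ⟨ξ, h, hs, rfl⟩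
      rw [← heq] at hmem
      obtain ⟨η, hη, hηs, he⟩ := hmem
      rw [coeff_unique hx ξ η hs hηs he k]
      exact hη k
    refine Set.Subset.antisymm (hsub k) (Set.Icc_subset_Icc ?_ ?_)
    · have hd : ∀ j, a j ≤ Function.update b k (a k) j ∧ Function.update b k (a k) j ≤ b j := by
        intro j
        by_cases hj : j = k
        · subst hj; simp [hab]
        · simp [hj, hab]
      obtain ⟨ξ, h, hs⟩ := exists_between_sum a (Function.update b k (a k))
        (fun j => (hd j).1) (by linarith) (by rw [sum_update_real]; linarith)
      have h1 := (key ξ (fun j => ⟨(h j).1, (h j).2.trans (hd j).2⟩) hs).1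
      have h2 := (h k).2
      simp only [Function.update_self] at h2
      exact h1.trans h2
    · have hd : ∀ j, a j ≤ Function.update a k (b k) j ∧ Function.update a k (b k) j ≤ b j := by
        intro j
        by_cases hj : j = k
        · subst hj; simp [hab]
        · simp [hj, hab]
      obtain ⟨ξ, h, hs⟩ := exists_between_sum (Function.update a k (b k)) b
        (fun j => (hd j).2) (by rw [sum_update_real]; linarith) (by linarith)
      have h1 := (key ξ (fun j => ⟨(hd j).1.trans (h j).1, (h j).2⟩) hs).2
      have h2 := (h k).1
      simp only [Function.update_self] at h2
      exact h2.trans h1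
end

section
/- Let ν₁, …, ν_m ∈ ℝ, set v = Σ_{j=1}^m ν_j x_j and δ = 1 − Σ_{j=1}^m ν_j, and assume δ ≠ 0, so that the homothety H_v^δ(x) = v + δx maps aff S into aff S. For each j define h_j(t) = ν_j + δt and I'_j = h_j(I_j) (the image of the interval I_j under h_j). Then H_v^δ(co(S, 𝒥_S)) = co(S, 𝒥'_S), where 𝒥'_S = {I'₁, …, I'_m}. -/
/-- The image of a convex interval hull under a homothety `H_v^δ` preserving
`aff S` is the convex interval hull associated with the transformed intervals
`I'_j = h_j(I_j)`, where `h_j(t) = ν_j + δ t`. -/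
theorem convex_interval_hull_homothety {L : Type*} [AddCommGroup L] [Module ℝ L]
    (m : ℕ) (x : Fin m → L) (I : Fin m → Set ℝ)
    (hne : ∀ j, (I j).Nonempty) (hoc : ∀ j, (I j).OrdConnected)
    (ν : Fin m → ℝ) (v : L) (hv : v = ∑ j, ν j • x j)
    (δ : ℝ) (hδ : δ = 1 - ∑ j, ν j) (hδ0 : δ ≠ 0) :
    (fun z : L => v + δ • z) '' {y : L | ∃ ξ : Fin m → ℝ,
        (∀ j, ξ j ∈ I j) ∧ (∑ j, ξ j) = 1 ∧ y = ∑ j, ξ j • x j} =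
      {y : L | ∃ η : Fin m → ℝ,
        (∀ j, η j ∈ (fun t => ν j + δ * t) '' I j) ∧ (∑ j, η j) = 1 ∧
        y = ∑ j, η j • x j} := by
  have key : ∀ ξ : Fin m → ℝ,
      ∑ j, (ν j + δ * ξ j) • x j = v + δ • ∑ j, ξ j • x j := by
    intro ξ
    simp only [add_smul, mul_smul, Finset.sum_add_distrib, Finset.smul_sum, hv]
  have ksum : ∀ ξ : Fin m → ℝ,
      ∑ j, (ν j + δ * ξ j) = (1 - δ) + δ * ∑ j, ξ j := by
    intro ξ
    rw [Finset.sum_add_distrib, ← Finset.mul_sum, hδ]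
    ring
  ext y
  constructor
  · rintro ⟨z, ⟨ξ, hI, hs, rfl⟩, rfl⟩
    refine ⟨fun j => ν j + δ * ξ j, fun j => ⟨ξ j, hI j, rfl⟩, ?_, (key ξ).symm⟩
    rw [ksum, hs]
    ring
  · rintro ⟨η, hI, hs, rfl⟩
    choose ξ hξ hη using hI
    obtain rfl : (fun j => ν j + δ * ξ j) = η := funext hη
    refine ⟨_, ⟨ξ, hξ, ?_, rfl⟩, (key ξ).symm⟩
    rw [ksum] at hs
    apply mul_left_cancel₀ hδ0
    linarith
end

section
/- Let c₁, …, c_m ∈ ℝ with γ = Σ_{j=1}^m c_j ≠ 1. Define h_j(t) = c_j + (1 − γ)t and let 𝒥'_S = {I'₁, …, I'_m} with I'_j = h_j([0, 1]) (the image of [0,1] under h_j). Then co(S, 𝒥'_S) = H_v^{1−γ}(conv S), where v = Σ_{j=1}^m c_j x_j; that is, co(S, 𝒥'_S) equals the image of the convex hull of {x₁, …, x_m} under the map x ↦ v + (1 − γ)x. -/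
theorem aux_hull {L : Type*} [AddCommGroup L] [Module ℝ L] (m : ℕ) (x : Fin m → L) :
    convexHull ℝ (Set.range x) = (Fintype.linearCombination ℝ x) '' stdSimplex ℝ (Fin m) := by
  rw [← convexHull_basis_eq_stdSimplex, LinearMap.image_convexHull, ← Set.range_comp]
  congr 2
  ext i
  simp [Fintype.linearCombination_apply]

/-- With `γ = Σ c_j ≠ 1` and `I'_j = h_j([0,1])`, `h_j(t) = c_j + (1 - γ) t`,
the convex interval hull `co(S, 𝒥'_S)` is the homothet `H_v^{1-γ}(conv S)`
with `v = Σ c_j x_j`. -/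
theorem convex_interval_hull_homothet_of_conv {L : Type*} [AddCommGroup L]
    [Module ℝ L] (m : ℕ) (x : Fin m → L) (c : Fin m → ℝ)
    (hγ : (∑ j, c j) ≠ 1) (v : L) (hv : v = ∑ j, c j • x j) :
    {y : L | ∃ ξ : Fin m → ℝ,
        (∀ j, ξ j ∈ (fun t => c j + (1 - ∑ i, c i) * t) '' Set.Icc (0 : ℝ) 1) ∧
        (∑ j, ξ j) = 1 ∧ y = ∑ j, ξ j • x j} =
      (fun z : L => v + (1 - ∑ i, c i) • z) '' convexHull ℝ (Set.range x) := by
  have hd : (1 - ∑ i, c i) ≠ 0 := sub_ne_zero.mpr hγ.symm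
  have key : ∀ t : Fin m → ℝ, ∑ j, (c j + (1 - ∑ i, c i) * t j) • x j
      = v + (1 - ∑ i, c i) • ∑ j, t j • x j := by
    intro t
    simp only [add_smul, mul_smul, Finset.sum_add_distrib, Finset.smul_sum, hv]
  rw [aux_hull]
  ext y
  constructor
  · rintro ⟨ξ, hξ, h1, rfl⟩
    choose t ht hte using hξ
    obtain rfl : (fun j => c j + (1 - ∑ i, c i) * t j) = ξ := funext hte
    refine ⟨_, ⟨t, ⟨fun j => (ht j).1, ?_⟩, rfl⟩, ?_⟩
    · rw [Finset.sum_add_distrib, ← Finset.mul_sum] at h1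
      apply mul_left_cancel₀ hd
      linarith
    · simp only [Fintype.linearCombination_apply]
      exact (key t).symm
  · rintro ⟨_, ⟨t, ⟨h0, h1⟩, rfl⟩, rfl⟩
    refine ⟨fun j => c j + (1 - ∑ i, c i) * t j, fun j => ⟨t j, ⟨h0 j, ?_⟩, rfl⟩, ?_, ?_⟩
    · rw [← h1]
      exact Finset.single_le_sum (fun i _ => h0 i) (Finset.mem_univ j)
    · rw [Finset.sum_add_distrib, ← Finset.mul_sum, h1]
      ring
    · simp only [Fintype.linearCombination_apply]
      exact (key t).symm
end

section
/- Let 𝒥 = {I₁, …, I_m}, I_j = [a_j, b_j], be an irreducible family of bounded closed intervals with α = Σ a_j, β = Σ b_j and α ≤ 1 ≤ β. For j, k ∈ {1, …, m} define I_j⁰ = [a_j, a_j + (1 − α)], and I_j^k = [a_j, a_j + (1 − α) − (b_k − a_k)] for j ≠ k, I_k^k = (b_k, a_k + (1 − α)]. Set B = (I₁ × ⋯ × I_m) ∩ Π₁ and B_u = Π₁ ∩ ⋃_{k=1}^m (I₁^k × ⋯ × I_m^k). Then B ∩ B_u = ∅ and B ∪ B_u = (I₁⁰ × ⋯ × I_m⁰)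 ∩ Π₁. -/
/-- Lemma on the decomposition of `(I₁⁰ × ⋯ × I_m⁰) ∩ Π₁` into the disjoint
union of `B = (I₁ × ⋯ × I_m) ∩ Π₁` and `B_u = Π₁ ∩ ⋃_k (I₁^k × ⋯ × I_m^k)`
for an irreducible family of intervals. -/
theorem convex_interval_hull_decomposition (m : ℕ) (a b : Fin m → ℝ)
    (hab : ∀ j, a j ≤ b j)
    (hirr : ∀ k, b k - a k ≤ min (1 - ∑ j, a j) ((∑ j, b j) - 1))
    (hα : (∑ j, a j) ≤ 1) (hβ : (1 : ℝ) ≤ ∑ j, b j)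
    (B Bu : Set (Fin m → ℝ))
    (hB : B = {p : Fin m → ℝ |
      (∀ j, p j ∈ Set.Icc (a j) (b j)) ∧ (∑ j, p j) = 1})
    (hBu : Bu = {p : Fin m → ℝ | (∑ j, p j) = 1 ∧ ∃ k,
      p k ∈ Set.Ioc (b k) (a k + (1 - ∑ i, a i)) ∧
      ∀ j, j ≠ k →
        p j ∈ Set.Icc (a j) (a j + (1 - ∑ i, a i) - (b k - a k))}) :
    B ∩ Bu = ∅ ∧
      B ∪ Bu = {p : Fin m → ℝ |
        (∀ j, p j ∈ Set.Icc (a j) (a j + (1 - ∑ i, a i))) ∧ (∑ j, p j) = 1} := by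
  subst hB hBu
  constructor
  · ext p
    simp only [Set.mem_inter_iff, Set.mem_setOf_eq, Set.mem_empty_iff_false, iff_false]
    rintro ⟨⟨h, _⟩, _, k, hk, _⟩
    exact absurd (h k).2 (not_le.mpr hk.1)
  · ext p
    simp only [Set.mem_union, Set.mem_setOf_eq]
    constructor
    · rintro (⟨h, hs⟩ | ⟨hs, k, hk, h⟩)
      · refine ⟨fun j => ⟨(h j).1, ?_⟩, hs⟩
        have h1 := (hirr j).trans (min_le_left _ _)
        have h2 := (h j).2
        linarith
      · refine ⟨fun j => ?_, hs⟩
        by_cases hj : j = k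
        · subst hj
          exact ⟨(hab j).trans hk.1.le, hk.2⟩
        · have h1 := h j hj
          have h2 := hab k
          exact ⟨h1.1, by linarith [h1.2]⟩
    · rintro ⟨h, hs⟩
      by_cases hp : ∀ j, p j ≤ b j
      · exact Or.inl ⟨fun j => ⟨(h j).1, hp j⟩, hs⟩
      · push Not at hp
        obtain ⟨k, hk⟩ := hp
        refine Or.inr ⟨hs, k, ⟨hk, (h k).2⟩, fun j hj => ⟨(h j).1, ?_⟩⟩
        have h1 : ∑ i ∈ ({j, k} : Finset (Fin m)), (p i - a i) ≤ ∑ i, (p i - a i) :=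
          Finset.sum_le_sum_of_subset_of_nonneg (Finset.subset_univ _)
            (fun i _ _ => sub_nonneg.mpr (h i).1)
        rw [Finset.sum_pair hj, Finset.sum_sub_distrib, hs] at h1
        linarith
end
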